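/- Let m ≥ 1 be an integer, and for each i ∈ {1,…,m} let α_i ∈ (1,2), w_i > 0, and n_i ≥ 1. Then the multilevel matrix P = Σ_{i=1}^m I_{n_1}⊗⋯⊗I_{n_{i−1}}⊗(w_i·τ(G_{n_i}^{(α_i)}))⊗I_{n_{i+1}}⊗⋯⊗I_{n_m} is symmetric positive definite. -/

import Mathlib

/-- Grünwald–Letnikov coefficients: `g 0 = 1`, `g k = (1 - (α+1)/k) * g (k-1)` for `k ≥ 1`. -/
noncomputable def glCoef (α : ℝ) : ℕ → ℝ
  | 0 => 1
  | k + 1 => (1 - (α + 1) / ((k : ℝ) + 1)) * glCoef α k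

/-- First-column entries of `G_n^{(α)}`: `t_0 = -2g_1`, `t_1 = -(g_0+g_2)`, `t_k = -g_{k+1}` for `k ≥ 2`. -/
noncomputable def tC (α : ℝ) : ℕ → ℝ
  | 0 => -2 * glCoef α 1
  | 1 => -(glCoef α 0 + glCoef α 2)
  | k + 2 => -glCoef α (k + 3)

/-- Padded coefficients: `t_k` for `k < n`, `0` for `k ≥ n`. -/
noncomputable def tpad (n : ℕ) (t : ℕ → ℝ) (k : ℕ) : ℝ := if k < n then t k else 0

/-- The `n×n` symmetric Toeplitz matrix with `(i,j)` entry `t_{|i-j|}`. -/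
noncomputable def toeplitzM (n : ℕ) (t : ℕ → ℝ) : Matrix (Fin n) (Fin n) ℝ :=
  fun i j => t (Nat.dist i.val j.val)

/-- The Hankel matrix `(H_n)_{ij} = t_{i+j} + t_{2(n+1)-(i+j)}` (1-based indices,
with the convention `t_k = 0` for `k ≥ n`). Here `i j : Fin n` are 0-based. -/
noncomputable def hankelM (n : ℕ) (t : ℕ → ℝ) : Matrix (Fin n) (Fin n) ℝ :=
  fun i j => tpad n t (i.val + j.val + 2) + tpad n t (2 * n - (i.val + j.val))

/-- The τ-matrix `τ(T_n) = T_n - H_n`. -/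
noncomputable def tauM (n : ℕ) (t : ℕ → ℝ) : Matrix (Fin n) (Fin n) ℝ :=
  toeplitzM n t - hankelM n t

/-- The matrix `G_n^{(α)}`. -/
noncomputable def Gmat (α : ℝ) (n : ℕ) : Matrix (Fin n) (Fin n) ℝ := toeplitzM n (tC α)

/-- The multilevel matrix `Σ_i I_{n_1}⊗⋯⊗M_i⊗⋯⊗I_{n_m}`, indexed by tuples `x y` with
`(x,y)` entry `Σ_i (M_i)_{x_i y_i} · Π_{j ≠ i} [x_j = y_j]`. -/
noncomputable def multilevel {m : ℕ} (n : Fin m → ℕ)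
    (M : (i : Fin m) → Matrix (Fin (n i)) (Fin (n i)) ℝ) :
    Matrix ((i : Fin m) → Fin (n i)) ((i : Fin m) → Fin (n i)) ℝ :=
  fun x y => ∑ i, M i (x i) (y i) * ∏ j ∈ Finset.univ.erase i, (if x j = y j then (1 : ℝ) else 0)

open Finset in
/-- A symmetric real matrix that is strictly diagonally dominant with positive diagonal is positive
definite. -/
theorem Matrix.IsSymm.posDef_of_sum_abs_lt {ι : Type*} [Fintype ι] [DecidableEq ι]
    {A : Matrix ι ι ℝ} (hA : A.IsSymm) (h : ∀ x, ∑ y, |A x y| < 2 * A x x) : A.PosDef := by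
  have hH : A.IsHermitian := by
    rw [Matrix.IsHermitian, Matrix.conjTranspose_eq_transpose_of_trivial]
    exact hA
  rw [hH.posDef_iff_eigenvalues_pos]
  intro i
  have hev : Module.End.HasEigenvalue (Matrix.toLin' A) (hH.eigenvalues i) := by
    rw [Module.End.hasEigenvalue_iff_mem_spectrum, Matrix.spectrum_toLin']
    exact hH.eigenvalues_mem_spectrum_real i
  obtain ⟨k, hk⟩ := eigenvalue_mem_ball hev
  rw [Metric.mem_closedBall, Real.dist_eq] at hk
  have hsum := Finset.add_sum_erase univ (fun y => |A k y|) (mem_univ k)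
  have hlt := h k
  simp only [Real.norm_eq_abs] at hk
  have h1 := le_abs_self (A k k)
  have h2 := neg_abs_le (hH.eigenvalues i - A k k)
  linarith

theorem isSymm_multilevel {m : ℕ} {n : Fin m → ℕ}
    {M : (i : Fin m) → Matrix (Fin (n i)) (Fin (n i)) ℝ} (hM : ∀ i, (M i).IsSymm) :
    (multilevel n M).IsSymm := by
  ext x y
  simp only [Matrix.transpose_apply, multilevel, eq_comm, (hM _).apply]

theorem multilevel_apply_self {m : ℕ} (n : Fin m → ℕ)
    (M : (i : Fin m) → Matrix (Fin (n i)) (Fin (n i)) ℝ) (x : (i : Fin m) → Fin (n i)) :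
    multilevel n M x x = ∑ i, M i (x i) (x i) := by
  simp [multilevel]

/-- Summing a function of one coordinate over the line through `x` in that direction. -/
theorem sum_mul_prod_erase_ite {m : ℕ} {n : Fin m → ℕ} (x : (i : Fin m) → Fin (n i)) (i : Fin m)
    (f : Fin (n i) → ℝ) :
    ∑ y : (i : Fin m) → Fin (n i),
      f (y i) * ∏ j ∈ Finset.univ.erase i, (if x j = y j then (1 : ℝ) else 0) = ∑ a, f a := by
  symm
  apply Finset.sum_of_injOn (fun a => Function.update x i a)
  · intro a _ b _ hab
    simpa using congrFun hab i
  · simp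
  · intro y _ hy
    rw [mul_eq_zero, Finset.prod_eq_zero_iff]
    right
    by_contra! hne
    apply hy
    refine ⟨y i, by simp, ?_⟩
    ext j
    by_cases hj : j = i
    · subst hj; simp
    · have := hne j (by simp [hj])
      simp only [ne_eq, ite_eq_right_iff, one_ne_zero, imp_false, not_not] at this
      simp [Function.update_of_ne hj, this]
  · intro a _
    rw [Finset.prod_eq_one, Function.update_self, mul_one]
    intro j hj
    simp [Function.update_of_ne (Finset.ne_of_mem_erase hj)]

theorem sum_abs_multilevel_le {m : ℕ} (n : Fin m → ℕ)
    (M : (i : Fin m) → Matrix (Fin (n i)) (Fin (n i)) ℝ) (x : (i : Fin m) → Fin (n i)) :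
    ∑ y, |multilevel n M x y| ≤ ∑ i, ∑ a, |M i (x i) a| := by
  calc ∑ y, |multilevel n M x y|
      ≤ ∑ y : (i : Fin m) → Fin (n i), ∑ i, |M i (x i) (y i)| *
          ∏ j ∈ Finset.univ.erase i, (if x j = y j then (1 : ℝ) else 0) := by
        refine Finset.sum_le_sum fun y _ => (Finset.abs_sum_le_sum_abs _ _).trans_eq ?_
        refine Finset.sum_congr rfl fun i _ => ?_
        rw [abs_mul, Finset.abs_prod]
        simp only [apply_ite abs, abs_one, abs_zero]
    _ = ∑ i, ∑ a, |M i (x i) a| := by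
        rw [Finset.sum_comm]
        exact Finset.sum_congr rfl fun i _ => sum_mul_prod_erase_ite x i fun a => |M i (x i) a|

theorem isSymm_tauM (n : ℕ) (t : ℕ → ℝ) : (tauM n t).IsSymm := by
  ext i j
  simp only [Matrix.transpose_apply, tauM, Matrix.sub_apply, toeplitzM, hankelM, Nat.dist_comm,
    add_comm]

open Finset in
/-- In each row of `τ(T_n)` the coefficient `t_0` is used once and each other one at most twice. -/
theorem sum_dist_add_sum_hankel_le {n i : ℕ} (hi : i < n) {s : ℕ → ℝ} (hs : ∀ k, 0 ≤ s k)
    (hs0 : ∀ k, n ≤ k → s k = 0) :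
    ∑ j ∈ range n, (s (Nat.dist i j) + (s (i + j + 2) + s (2 * n - (i + j)))) ≤
      2 * ∑ k ∈ range n, s k - s 0 := by
  have hle : ∀ N, ∑ k ∈ range N, s k ≤ ∑ k ∈ range n, s k := fun N => by
    rcases le_total N n with h | h
    · exact sum_le_sum_of_subset_of_nonneg (range_mono h) fun k _ _ => hs k
    · exact (sum_subset (range_mono h) fun k _ hk => hs0 k (by simpa using hk)).ge
  have h1 : ∑ j ∈ range n, s (Nat.dist i j) =
      ∑ k ∈ range (i + 1), s k + (∑ k ∈ range (n - i), s k - s 0) := by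
    obtain ⟨d, rfl⟩ : ∃ d, n = (i + 1) + d := ⟨n - (i + 1), by omega⟩
    rw [sum_range_add, ← sum_range_reflect, show i + 1 + d - i = d + 1 by omega,
      sum_range_succ' (n := d)]
    rw [add_sub_cancel_right]
    congr 1
    · refine sum_congr rfl fun j hj => ?_
      rw [mem_range] at hj
      congr 1
      rw [Nat.dist]; omega
    · refine sum_congr rfl fun j _ => ?_
      congr 1
      rw [Nat.dist]; omega
  have h2 : ∑ j ∈ range n, s (i + j + 2) =
      ∑ k ∈ range (i + 2 + n), s k - ∑ k ∈ range (i + 2), s k := by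
    rw [sum_range_add, add_sub_cancel_left]
    exact sum_congr rfl fun j _ => by congr 1; omega
  have h3 : ∑ j ∈ range n, s (2 * n - (i + j)) =
      ∑ k ∈ range (n - i + 1 + n), s k - ∑ k ∈ range (n - i + 1), s k := by
    rw [sum_range_add, add_sub_cancel_left, ← sum_range_reflect]
    refine sum_congr rfl fun j hj => ?_
    rw [mem_range] at hj
    congr 1; omega
  rw [sum_add_distrib, sum_add_distrib, h1, h2, h3, sum_range_succ _ (i + 1),
    sum_range_succ _ (n - i)]
  linarith [hle (i + 2 + n), hle (n - i + 1 + n), hs (i + 1), hs (n - i)]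

open Finset in
theorem sum_abs_tauM_le (n : ℕ) (t : ℕ → ℝ) (i : Fin n) :
    ∑ j, |tauM n t i j| ≤ 2 * ∑ k ∈ range n, |t k| - |t 0| := by
  have key := sum_dist_add_sum_hankel_le i.isLt (s := fun k => |tpad n t k|)
    (fun k => abs_nonneg _) (fun k hk => by simp [tpad, not_lt.mpr hk])
  have hr : ∑ k ∈ range n, |tpad n t k| = ∑ k ∈ range n, |t k| :=
    sum_congr rfl fun k hk => by rw [tpad, if_pos (mem_range.mp hk)]
  have h0 : tpad n t 0 = t 0 := if_pos i.pos
  simp only [hr, h0] at key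
  refine le_trans ?_ key
  rw [← Fin.sum_univ_eq_sum_range
    (fun j => |tpad n t (Nat.dist i j)| + (|tpad n t (i + j + 2)| + |tpad n t (2 * n - (i + j))|))]
  refine sum_le_sum fun j _ => ?_
  have hd : t (Nat.dist i j) = tpad n t (Nat.dist i j) := by
    rw [tpad, if_pos]
    rw [Nat.dist]; omega
  simp only [tauM, Matrix.sub_apply, toeplitzM, hankelM, hd]
  exact (abs_sub _ _).trans (add_le_add_right (abs_add_le _ _) _)

theorem le_tauM_apply_self {n : ℕ} {t : ℕ → ℝ} (ht : ∀ k, t (k + 1) ≤ 0) (i : Fin n) :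
    t 0 ≤ tauM n t i i := by
  have hp : ∀ k, 0 < k → tpad n t k ≤ 0 := fun k hk => by
    obtain ⟨l, rfl⟩ := Nat.exists_eq_add_of_lt hk
    rw [tpad]
    split_ifs
    · simpa using ht l
    · exact le_rfl
  have h1 := hp (i + i + 2) (by omega)
  have h2 := hp (2 * n - (i + i)) (by omega)
  simp only [tauM, Matrix.sub_apply, toeplitzM, hankelM, Nat.dist_self]
  linarith

theorem glCoef_one (α : ℝ) : glCoef α 1 = -α := by
  simp [glCoef]

theorem glCoef_add_two_pos {α : ℝ} (hα : α ∈ Set.Ioo (1 : ℝ) 2) (k : ℕ) :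
    0 < glCoef α (k + 2) := by
  obtain ⟨h1, h2⟩ := hα
  induction k with
  | zero =>
    have : glCoef α 2 = α * (α - 1) / 2 := by simp [glCoef]; ring
    rw [zero_add, this]
    nlinarith
  | succ k ih =>
    rw [glCoef]
    refine mul_pos ?_ ih
    push_cast
    rw [sub_pos, div_lt_one (by positivity)]
    have : (0 : ℝ) ≤ k := k.cast_nonneg
    linarith

open Finset in
theorem mul_sum_range_glCoef (α : ℝ) (N : ℕ) :
    α * ∑ k ∈ range (N + 1), glCoef α k = (α - N) * glCoef α N := by
  induction N with
  | zero => simp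
  | succ N ih =>
    rw [sum_range_succ, mul_add, ih, glCoef]
    push_cast
    field_simp
    ring

theorem tC_succ_nonpos {α : ℝ} (hα : α ∈ Set.Ioo (1 : ℝ) 2) (k : ℕ) : tC α (k + 1) ≤ 0 := by
  cases k with
  | zero =>
    have := glCoef_add_two_pos hα 0
    simp only [tC, zero_add, glCoef.eq_1] at this ⊢
    linarith
  | succ k => simpa [tC] using (glCoef_add_two_pos hα (k + 1)).le

open Finset in
theorem sum_range_abs_tC {α : ℝ} (hα : α ∈ Set.Ioo (1 : ℝ) 2) (n : ℕ) :
    ∑ k ∈ range (n + 2), |tC α k| = 3 * α + ∑ k ∈ range (n + 3), glCoef α k := by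
  induction n with
  | zero =>
    have h0 : |tC α 0| = 2 * α := by
      rw [tC, glCoef_one, abs_of_nonneg] <;> linarith [hα.1]
    have h1 := abs_of_nonpos (tC_succ_nonpos hα 0)
    simp only [zero_add] at h1
    simp only [zero_add, sum_range_succ, range_zero, sum_empty, h0, h1]
    rw [glCoef_one, tC]
    ring
  | succ n ih =>
    rw [sum_range_succ, ih, sum_range_succ _ (n + 3), abs_of_nonpos (tC_succ_nonpos hα (n + 1)), tC]
    ring

open Finset in
theorem sum_range_abs_tC_lt {α : ℝ} (hα : α ∈ Set.Ioo (1 : ℝ) 2) (n : ℕ) :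
    ∑ k ∈ range n, |tC α k| < 3 * α := by
  have hN : ∑ k ∈ range (n + 2), |tC α k| < 3 * α := by
    rw [sum_range_abs_tC hα]
    have h := mul_sum_range_glCoef α (n + 2)
    have hneg : (α - (n + 2 : ℕ)) * glCoef α (n + 2) < 0 := by
      refine mul_neg_of_neg_of_pos ?_ (glCoef_add_two_pos hα n)
      have : (0 : ℝ) ≤ n := n.cast_nonneg
      push_cast
      linarith [hα.2]
    rw [← h] at hneg
    linarith [neg_of_mul_neg_right hneg (by linarith [hα.1])]
  exact (sum_le_sum_of_subset_of_nonneg (range_mono (by omega)) fun _ _ _ => abs_nonneg _).trans_lt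
    hN

theorem sum_abs_tauM_tC_lt {α : ℝ} (hα : α ∈ Set.Ioo (1 : ℝ) 2) (n : ℕ) (i : Fin n) :
    ∑ j, |tauM n (tC α) i j| < 2 * tauM n (tC α) i i := by
  have h0 : tC α 0 = 2 * α := by rw [tC, glCoef_one]; ring
  have h1 := sum_abs_tauM_le n (tC α) i
  have h2 := le_tauM_apply_self (tC_succ_nonpos hα) i
  have h3 := sum_range_abs_tC_lt hα n
  rw [h0, abs_of_pos (by linarith [hα.1])] at h1
  linarith

theorem multilevel_tau_posDef (m : ℕ) (hm : 1 ≤ m) (n : Fin m → ℕ) (hn : ∀ i, 1 ≤ n i)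
    (α w : Fin m → ℝ) (hα : ∀ i, α i ∈ Set.Ioo (1 : ℝ) 2) (hw : ∀ i, 0 < w i) :
    (multilevel n (fun i => w i • tauM (n i) (tC (α i)))).IsSymm ∧
    (multilevel n (fun i => w i • tauM (n i) (tC (α i)))).PosDef := by
  have hS := isSymm_multilevel (n := n) (M := fun i => w i • tauM (n i) (tC (α i)))
    fun i => (isSymm_tauM (n i) (tC (α i))).smul (w i)
  refine ⟨hS, hS.posDef_of_sum_abs_lt fun x => (sum_abs_multilevel_le _ _ x).trans_lt ?_⟩
  rw [multilevel_apply_self, Finset.mul_sum]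
  refine Finset.sum_lt_sum_of_nonempty ⟨⟨0, hm⟩, Finset.mem_univ _⟩ fun i _ => ?_
  simp only [Matrix.smul_apply, smul_eq_mul, abs_mul, abs_of_pos (hw i), ← Finset.mul_sum]
  rw [mul_left_comm]
  exact mul_lt_mul_of_pos_left (sum_abs_tauM_tC_lt (hα i) (n i) (x i)) (hw i)
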